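/- arXiv:1201.5333 — 2 statements merged into one kernel-verified Lean document; each statement's English description precedes it below -/
import Mathlib

section
/- Let N ≥ 1 be a natural number, let (a_n)_{n≥0} be any sequence of real numbers, and set Λ_n = n + n(n−1)/N. For each integer p ≥ 0 define y_p : ℝ → ℝ by y_p(t) = p! · Σ_{n=0}^{p} binom(p, p−n) · a_n / (N+2n)_{p−n} · e^{−Λ_n t}. Then for every integer p ≥ 1 and every t ∈ ℝ, y_p is differentiable at t and y_p'(t) = −Λ_p · y_p(t) + (p²/N) · y_{p−1}(t). -/
open Finset

/-- Pochhammer symbol `(x)_k = x (x+1) ⋯ (x+k-1)`, with `(x)_0 = 1`. -/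
noncomputable def poch (x : ℝ) (k : ℕ) : ℝ := ∏ i ∈ Finset.range k, (x + i)

theorem poch_succ (x : ℝ) (k : ℕ) : poch x (k + 1) = poch x k * (x + k) :=
  Finset.prod_range_succ _ _

theorem poch_pos {x : ℝ} (hx : 0 < x) (k : ℕ) : 0 < poch x k :=
  Finset.prod_pos fun _ _ => by positivity

/-- The recursion satisfied by the coefficients `binom(p, p - n) / (N + 2n)_{p - n}`,
written with `p = n + k + 1`. -/
theorem choose_div_poch_recursion {N : ℝ} (hN : 0 < N) (n k : ℕ) :
    ((n + k + 1).choose (k + 1) : ℝ) / poch (N + 2 * n) (k + 1) *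
        ((k + 1) * (N + 2 * n + k)) =
      (n + k + 1) * ((n + k).choose k / poch (N + 2 * n) k) := by
  have hchoose : ((n + k + 1 : ℕ) : ℝ) * (n + k).choose k =
      (n + k + 1).choose (k + 1) * ((k + 1 : ℕ) : ℝ) := by
    exact_mod_cast Nat.add_one_mul_choose_eq (n + k) k
  have hpoch : poch (N + 2 * n) k ≠ 0 := (poch_pos (by positivity) k).ne'
  have hfactor : N + 2 * n + k ≠ 0 := by positivity
  rw [poch_succ]
  push_cast at hchoose
  field_simp
  linear_combination -hchoose

theorem stmt0 (N : ℕ) (hN : 1 ≤ N) (a : ℕ → ℝ)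
    (Λ : ℕ → ℝ) (hΛ : ∀ n : ℕ, Λ n = (n : ℝ) + (n : ℝ) * ((n : ℝ) - 1) / N)
    (y : ℕ → ℝ → ℝ)
    (hy : ∀ p : ℕ, ∀ t : ℝ, y p t =
      (Nat.factorial p : ℝ) *
        ∑ n ∈ Finset.range (p + 1),
          (Nat.choose p (p - n) : ℝ) * a n / poch ((N : ℝ) + 2 * n) (p - n) *
            Real.exp (-(Λ n) * t))
    (p : ℕ) (hp : 1 ≤ p) (t : ℝ) :
    HasDerivAt (y p) (-(Λ p) * y p t + ((p : ℝ) ^ 2 / N) * y (p - 1) t) t := by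
  obtain ⟨m, rfl⟩ : ∃ m, p = m + 1 := ⟨p - 1, by omega⟩
  have hN0 : (0 : ℝ) < N := by exact_mod_cast hN
  have hderiv : HasDerivAt (y (m + 1)) (((m + 1).factorial : ℝ) *
      ∑ n ∈ Finset.range (m + 1 + 1),
        ((m + 1).choose (m + 1 - n) : ℝ) * a n / poch ((N : ℝ) + 2 * n) (m + 1 - n) *
          (Real.exp (-(Λ n) * t) * -(Λ n))) t := by
    rw [funext (hy (m + 1))]
    refine (HasDerivAt.fun_sum fun n _ => HasDerivAt.const_mul _ ?_).const_mul _
    simpa using ((hasDerivAt_id t).const_mul (-(Λ n))).exp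
  convert hderiv using 1
  have hterm : ∀ n ∈ Finset.range (m + 1),
      ((m + 1).choose (m + 1 - n) : ℝ) * a n / poch ((N : ℝ) + 2 * n) (m + 1 - n) *
          (Real.exp (-(Λ n) * t) * -(Λ n)) =
        -(Λ (m + 1)) * (((m + 1).choose (m + 1 - n) : ℝ) * a n /
            poch ((N : ℝ) + 2 * n) (m + 1 - n) * Real.exp (-(Λ n) * t)) +
          ((m + 1 : ℝ) / N) * ((m.choose (m - n) : ℝ) * a n /
            poch ((N : ℝ) + 2 * n) (m - n) * Real.exp (-(Λ n) * t)) := by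
    intro n hn
    obtain ⟨k, rfl⟩ := Nat.exists_eq_add_of_le (Nat.lt_succ_iff.mp (Finset.mem_range.mp hn))
    have hgap : Λ (n + k + 1) - Λ n = (k + 1) * (N + 2 * n + k) / N := by
      rw [hΛ, hΛ]
      push_cast
      field_simp
      ring
    rw [show n + k + 1 - n = k + 1 by omega, show n + k - n = k by omega]
    push_cast
    linear_combination (a n * Real.exp (-(Λ n) * t) / N) * choose_div_poch_recursion hN0 n k +
      ((n + k + 1).choose (k + 1) / poch ((N : ℝ) + 2 * n) (k + 1) *
        a n * Real.exp (-(Λ n) * t)) * hgap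
  rw [hy, hy, Finset.sum_range_succ, Finset.sum_range_succ _ (m + 1),
    Finset.sum_congr rfl hterm, Finset.sum_add_distrib, ← Finset.mul_sum, ← Finset.mul_sum,
    Nat.add_sub_cancel, Nat.factorial_succ]
  push_cast
  ring
end

section
/- Let N ≥ 1 and n ≥ 0 be natural numbers, set Λ_k = k + k(k−1)/N for k ≥ 0, and let C = −Λ_n. Suppose (a_k)_{k≥0} is a sequence of real numbers satisfying a_0·C = 0 and a_k·(C + Λ_k) = (k/N)·a_{k−1} for every k ≥ 1. Then a_m = 0 for every m with 0 ≤ m < n, and a_{n+m} = a_n · binom(n+m, m) / (N+2n)_m for every m ≥ 0. -/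
/-- The eigenvalue recurrence with denominators cleared: since
`Λ k - Λ n = (k - n) (N + k + n - 1) / N`, the factor `1 / N` cancels. -/
lemma mul_sub_mul_eq_of_rec {N n k : ℕ} (hN : 1 ≤ N) {x y : ℝ}
    (h : x * (-((n : ℝ) + (n : ℝ) * ((n : ℝ) - 1) / N) + ((k : ℝ) + (k : ℝ) * ((k : ℝ) - 1) / N)) =
      ((k : ℝ) / N) * y) :
    x * (((k : ℝ) - n) * (N + k + n - 1)) = k * y := by
  have hN' : (N : ℝ) ≠ 0 := by positivity
  field_simp at h
  linear_combination h

theorem stmt4 (N n : ℕ) (hN : 1 ≤ N)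
    (Λ : ℕ → ℝ) (hΛ : ∀ k : ℕ, Λ k = (k : ℝ) + (k : ℝ) * ((k : ℝ) - 1) / N)
    (C : ℝ) (hC : C = -Λ n)
    (a : ℕ → ℝ)
    (h0 : a 0 * C = 0)
    (hrec : ∀ k : ℕ, 1 ≤ k → a k * (C + Λ k) = ((k : ℝ) / N) * a (k - 1)) :
    (∀ m : ℕ, m < n → a m = 0) ∧
    (∀ m : ℕ, a (n + m) =
      a n * (Nat.choose (n + m) m : ℝ) / poch ((N : ℝ) + 2 * n) m) := by
  have hN1 : (1 : ℝ) ≤ N := by exact_mod_cast hN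
  have hclear : ∀ k : ℕ, a (k + 1) * (((k : ℝ) + 1 - n) * (N + k + n)) = (k + 1) * a k := by
    intro k
    have h := hrec (k + 1) (by omega)
    rw [hC, hΛ n, hΛ (k + 1), Nat.add_sub_cancel] at h
    have h' := mul_sub_mul_eq_of_rec hN h
    push_cast at h'
    linear_combination h'
  refine ⟨fun m => ?_, fun m => ?_⟩
  · induction m with
    | zero =>
      intro hn
      have hn1 : (1 : ℝ) ≤ n := by exact_mod_cast hn
      refine (mul_eq_zero.mp h0).resolve_right ?_
      rw [hC, hΛ n]
      have : 0 ≤ (n : ℝ) * ((n : ℝ) - 1) / N :=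
        div_nonneg (mul_nonneg (by linarith) (by linarith)) (by linarith)
      linarith
    | succ k ih =>
      intro hk
      have h := hclear k
      rw [ih (by omega), mul_zero] at h
      refine (mul_eq_zero.mp h).resolve_right (mul_ne_zero ?_ (by positivity))
      have : (k : ℝ) + 1 < n := by exact_mod_cast hk
      linarith
  · induction m with
    | zero => simp [poch]
    | succ m ih =>
      have h := hclear (n + m)
      have hchoose : ((n + m + 1).choose (m + 1) : ℝ) * (m + 1) =
          (n + m + 1) * (n + m).choose m := by
        exact_mod_cast (Nat.add_one_mul_choose_eq (n + m) m).symm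
      have hp : poch ((N : ℝ) + 2 * n) m ≠ 0 :=
        Finset.prod_ne_zero_iff.mpr fun i _ => by positivity
      have hpoch : poch ((N : ℝ) + 2 * n) (m + 1) =
          poch ((N : ℝ) + 2 * n) m * (N + 2 * n + m) := Finset.prod_range_succ _ _
      have hq : (N : ℝ) + 2 * n + m ≠ 0 := by positivity
      have hm : (m : ℝ) + 1 ≠ 0 := by positivity
      rw [eq_div_iff hp] at ih
      rw [← add_assoc, hpoch, eq_div_iff (mul_ne_zero hp hq)]
      push_cast at h
      apply mul_right_cancel₀ hm
      linear_combination poch ((N : ℝ) + 2 * n) m * h + ((n : ℝ) + m + 1) * ih - a n * hchoose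
end
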